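/- arXiv:1801.03594 — 7 statements merged into one kernel-verified Lean document; each statement's English description precedes it below -/
import Mathlib

section
/- Let (Ω,𝔉,ℙ) be a probability space, M a positive integer, and X_1,…,X_M random variables with X_i taking values in a measurable space E_i. Let γ > 0 and μ ∈ (0,γ], and for each i ∈ {1,…,M} let f_i : E_1×⋯×E_i → ℝ be measurable with 0 ≤ f_i(X_1,…,X_i) ≤ γ almost surely and 𝔼[f_i(X_1,…,X_i) | X_1,…,X_{i−1}] ≤ μ almost surely. Then for every t ∈ [μ,γ], ℙ( (1/M)·Σ_{i=1}^M f_i(X_1,…,X_i) > t ) < exp( −M·d(t/γ, μ/γ) ), where d is the binary relative entropy in nats. -/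
open MeasureTheory ProbabilityTheory Real

/-- Binary relative entropy (in nats): `d(a,b) = a ln(a/b) + (1-a) ln((1-a)/(1-b))`.
With Lean's conventions `x/0 = 0` and `log 0 = 0`, this matches the standard
conventions `0·ln(0/b) = 0` and `0·ln(0/0) = 0` at all the corner cases arising for
`b ∈ (0,1]`, `a ∈ [b,1]`. -/
noncomputable def binRelEntropy (a b : ℝ) : ℝ :=
  a * Real.log (a / b) + (1 - a) * Real.log ((1 - a) / (1 - b))

/-- **Strict Markov inequality.** If a nonnegative integrable `Y` exceeds `K` almost everywhere on
an event `A` of positive measure, then `P(A) K < ∫ Y`. -/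
lemma measureReal_mul_lt_integral {Ω : Type*} [MeasurableSpace Ω] {P : Measure Ω}
    [IsFiniteMeasure P] {A : Set Ω} (hA : MeasurableSet A) (hA0 : P A ≠ 0) {Y : Ω → ℝ} {K : ℝ}
    (hY : Integrable Y P) (hY0 : 0 ≤ᵐ[P] Y) (hK : ∀ᵐ ω ∂P, ω ∈ A → K < Y ω) :
    P.real A * K < ∫ ω, Y ω ∂P := by
  have hK' : ∀ᵐ ω ∂(P.restrict A), K < Y ω := (ae_restrict_iff' hA).2 hK
  have hpos : 0 < ∫ ω in A, (Y ω - K) ∂P := by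
    rw [integral_pos_iff_support_of_nonneg_ae]
    · have hsupp : (Function.support fun ω => Y ω - K) =ᵐ[P.restrict A] Set.univ := by
        filter_upwards [hK'] with ω hω
        exact propext (iff_of_true (sub_pos.2 hω).ne' trivial)
      rw [measure_congr hsupp, Measure.restrict_apply_univ]
      exact pos_iff_ne_zero.2 hA0
    · filter_upwards [hK'] with ω hω
      exact (sub_pos.2 hω).le
    · exact hY.integrableOn.sub (integrable_const K)
  rw [integral_sub hY.integrableOn (integrable_const K), setIntegral_const, smul_eq_mul] at hpos
  linarith [setIntegral_le_integral (s := A) hY hY0]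

/-- If `E[g | m] ≤ μ` and `Y` is a nonnegative `m`-measurable weight, then
`E[Y g] ≤ μ E[Y]`. -/
lemma integral_mul_le_of_condExp_le {Ω : Type*} {m m0 : MeasurableSpace Ω} {P : Measure Ω}
    [IsFiniteMeasure P] (hm : m ≤ m0) {Y g : Ω → ℝ} {μ : ℝ} (hYm : StronglyMeasurable[m] Y)
    (hY0 : 0 ≤ᵐ[P] Y) (hY : Integrable Y P) (hg : Integrable g P)
    (hYg : Integrable (fun ω => Y ω * g ω) P) (hcond : ∀ᵐ ω ∂P, (P[g | m]) ω ≤ μ) :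
    ∫ ω, Y ω * g ω ∂P ≤ μ * ∫ ω, Y ω ∂P := by
  have hpull : P[fun ω => Y ω * g ω | m] =ᵐ[P] fun ω => Y ω * (P[g | m]) ω :=
    condExp_mul_of_stronglyMeasurable_left hYm hYg hg
  rw [← integral_condExp hm, ← integral_const_mul]
  refine integral_mono_ae integrable_condExp (hY.const_mul μ) ?_
  filter_upwards [hpull, hY0, hcond] with ω h1 h2 h3
  rw [h1, mul_comm μ]
  exact mul_le_mul_of_nonneg_left h3 h2

/-- The Chernoff exponent at the optimal base `r = a (1 - p) / (p (1 - a))`. -/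
lemma one_add_mul_pow_div_rpow_eq_exp_binRelEntropy {a p : ℝ} (hp : 0 < p) (hpa : p ≤ a)
    (ha : a < 1) (M : ℕ) :
    (1 + (a * (1 - p) / (p * (1 - a)) - 1) * p) ^ M / (a * (1 - p) / (p * (1 - a))) ^ (a * M) =
      exp (-(M : ℝ) * binRelEntropy a p) := by
  have ha0 : 0 < a := hp.trans_le hpa
  have ha1 : 0 < 1 - a := by linarith
  have hp1 : 0 < 1 - p := by linarith
  have hr : a * (1 - p) / (p * (1 - a)) = (a / p) / ((1 - a) / (1 - p)) := by field_simp
  have hbase : 1 + (a * (1 - p) / (p * (1 - a)) - 1) * p = ((1 - a) / (1 - p))⁻¹ := by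
    field_simp
    ring
  rw [hbase, hr]
  have hu : 0 < a / p := by positivity
  have hv : 0 < (1 - a) / (1 - p) := by positivity
  unfold binRelEntropy
  generalize a / p = u at *
  generalize (1 - a) / (1 - p) = v at *
  rw [← rpow_natCast, rpow_def_of_pos (inv_pos.2 hv), rpow_def_of_pos (div_pos hu hv),
    ← exp_sub, log_inv, log_div hu.ne' hv.ne']
  congr 1
  ring

/-- A process adapted to the σ-algebras generated by `X`, with values in `[0, γ]` and conditional
means at most `μ`, satisfies `E ∏ i < k, (1 + c f i) ≤ (1 + c μ) ^ k`. -/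
lemma integral_prod_one_add_mul_le {Ω : Type*} [MeasurableSpace Ω] (P : Measure Ω)
    [IsProbabilityMeasure P] {M : ℕ} {E : Fin M → Type*} [∀ i, MeasurableSpace (E i)]
    (X : ∀ i, Ω → E i) (hX : ∀ i, Measurable (X i)) {γ μ c : ℝ} (hμ : 0 ≤ μ) (hc : 0 ≤ c)
    (f : Fin M → Ω → ℝ)
    (hmeas : ∀ i : Fin M,
      Measurable[⨆ j : Fin M, ⨆ _ : j ≤ i, MeasurableSpace.comap (X j) inferInstance] (f i))
    (hbd : ∀ i : Fin M, ∀ᵐ ω ∂P, f i ω ∈ Set.Icc 0 γ)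
    (hcond : ∀ i : Fin M, ∀ᵐ ω ∂P,
      (P[f i | ⨆ j : Fin M, ⨆ _ : j < i, MeasurableSpace.comap (X j) inferInstance]) ω ≤ μ)
    (k : ℕ) (hk : k ≤ M) :
    Integrable (fun ω => ∏ i with i.val < k, (1 + c * f i ω)) P ∧
      ∫ ω, ∏ i with i.val < k, (1 + c * f i ω) ∂P ≤ (1 + c * μ) ^ k := by
  have hfm : ∀ i, Measurable (f i) := fun i =>
    (hmeas i).mono (iSup₂_le fun j _ => (hX j).comap_le) le_rfl
  have hall : ∀ᵐ ω ∂P, ∀ i, f i ω ∈ Set.Icc 0 γ := ae_all_iff.2 hbd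
  have hfi : ∀ i, Integrable (f i) P := fun i =>
    Integrable.of_mem_Icc 0 γ (hfm i).aemeasurable (hbd i)
  induction k with
  | zero => simp
  | succ k ih =>
    obtain ⟨hint, hle⟩ := ih (Nat.le_of_succ_le hk)
    set i₀ : Fin M := ⟨k, hk⟩
    set Y : Ω → ℝ := fun ω => ∏ i with i.val < k, (1 + c * f i ω)
    have hsplit : (Finset.univ.filter fun i : Fin M => i.val < k + 1) =
        insert i₀ (Finset.univ.filter fun i : Fin M => i.val < k) := by
      ext i
      simp only [Finset.mem_filter, Finset.mem_univ, true_and, Finset.mem_insert, Fin.ext_iff, i₀]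
      omega
    have hprod : (fun ω => ∏ i with i.val < k + 1, (1 + c * f i ω)) =
        fun ω => Y ω + c * (Y ω * f i₀ ω) := by
      ext ω
      rw [hsplit, Finset.prod_insert (by simp [i₀])]
      ring
    have hpast : (⨆ j : Fin M, ⨆ _ : j < i₀, MeasurableSpace.comap (X j) inferInstance) ≤
        ‹MeasurableSpace Ω› := iSup₂_le fun j _ => (hX j).comap_le
    have hYm : Measurable[⨆ j : Fin M, ⨆ _ : j < i₀,
        MeasurableSpace.comap (X j) inferInstance] Y := by
      refine Finset.measurable_fun_prod _ fun i hi => ?_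
      have hi' : i < i₀ := (Finset.mem_filter.1 hi).2
      have hfi' := (hmeas i).mono (iSup₂_le fun j hj =>
        le_iSup₂_of_le (f := fun (j : Fin M) (_ : j < i₀) =>
          MeasurableSpace.comap (X j) inferInstance) j (hj.trans_lt hi') le_rfl) le_rfl
      exact (hfi'.const_mul c).const_add 1
    have hY0 : 0 ≤ᵐ[P] Y := by
      filter_upwards [hall] with ω hω
      exact Finset.prod_nonneg fun i _ => add_nonneg zero_le_one (mul_nonneg hc (hω i).1)
    have hYf : Integrable (fun ω => Y ω * f i₀ ω) P := by
      refine hint.mul_bdd (c := γ) (hfm i₀).aestronglyMeasurable ?_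
      filter_upwards [hbd i₀] with ω hω
      rw [norm_of_nonneg hω.1]
      exact hω.2
    have hstep := integral_mul_le_of_condExp_le hpast hYm.stronglyMeasurable hY0 hint
      (hfi i₀) hYf (hcond i₀)
    rw [hprod, integral_add hint (hYf.const_mul c), integral_const_mul]
    refine ⟨hint.add (hYf.const_mul c), ?_⟩
    calc ∫ ω, Y ω ∂P + c * ∫ ω, Y ω * f i₀ ω ∂P
        ≤ ∫ ω, Y ω ∂P + c * (μ * ∫ ω, Y ω ∂P) := by gcongr
      _ = (∫ ω, Y ω ∂P) * (1 + c * μ) := by ring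
      _ ≤ (1 + c * μ) ^ k * (1 + c * μ) := by gcongr
      _ = (1 + c * μ) ^ (k + 1) := (pow_succ _ _).symm

/-- **Chernoff-type bound for dependent random variables with bounded conditional means**
(relative-entropy form).  With `f i` playing the role of `f_i(X_1,…,X_i)`
(measurable w.r.t. the σ-algebra generated by `X_0,…,X_i`, valued in `[0,γ]` a.s.,
conditional mean given the past at most `μ` a.s.), the empirical average exceeds
`t ∈ [μ,γ]` with probability strictly less than `exp(-M·d(t/γ, μ/γ))`. -/
theorem chernoff_bounded_condexp_relEntropy
    {Ω : Type*} [MeasurableSpace Ω] (P : Measure Ω) [IsProbabilityMeasure P]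
    {M : ℕ} (hM : 0 < M)
    {E : Fin M → Type*} [∀ i, MeasurableSpace (E i)]
    (X : ∀ i, Ω → E i) (hX : ∀ i, Measurable (X i))
    (γ μ : ℝ) (hγ : 0 < γ) (hμ0 : 0 < μ) (hμγ : μ ≤ γ)
    (f : Fin M → Ω → ℝ)
    (hmeas : ∀ i : Fin M,
      Measurable[⨆ j : Fin M, ⨆ _ : j ≤ i, MeasurableSpace.comap (X j) inferInstance] (f i))
    (hbd : ∀ i : Fin M, ∀ᵐ ω ∂P, f i ω ∈ Set.Icc 0 γ)
    (hcond : ∀ i : Fin M, ∀ᵐ ω ∂P,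
      (P[f i | ⨆ j : Fin M, ⨆ _ : j < i, MeasurableSpace.comap (X j) inferInstance]) ω ≤ μ)
    (t : ℝ) (ht : t ∈ Set.Icc μ γ) :
    (P {ω | t < (1 / (M : ℝ)) * ∑ i, f i ω}).toReal <
      Real.exp (-(M : ℝ) * binRelEntropy (t / γ) (μ / γ)) := by
  have hfm : ∀ i, Measurable (f i) := fun i =>
    (hmeas i).mono (iSup₂_le fun j _ => (hX j).comap_le) le_rfl
  have hall : ∀ᵐ ω ∂P, ∀ i, f i ω ∈ Set.Icc 0 γ := ae_all_iff.2 hbd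
  have hfi : ∀ i, Integrable (f i) P := fun i =>
    Integrable.of_mem_Icc 0 γ (hfm i).aemeasurable (hbd i)
  have hM' : (0 : ℝ) < M := Nat.cast_pos.2 hM
  set A : Set Ω := {ω | t < (1 / (M : ℝ)) * ∑ i, f i ω}
  have hA : MeasurableSet A := measurableSet_lt measurable_const
    ((Finset.measurable_fun_sum _ fun i _ => hfm i).const_mul _)
  change P.real A < _
  by_cases hA0 : P A = 0
  · rw [measureReal_def, hA0, ENNReal.toReal_zero]
    exact exp_pos _
  rcases ht.2.eq_or_lt with rfl | htγ
  · refine absurd (measure_eq_zero_iff_ae_notMem.2 ?_) hA0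
    filter_upwards [hall] with ω hω
    simp only [A, Set.mem_ofPred_eq, not_lt]
    rw [one_div, inv_mul_le_iff₀ hM']
    calc ∑ i, f i ω ≤ ∑ _i : Fin M, t := Finset.sum_le_sum fun i _ => (hω i).2
      _ = M * t := by simp
  rcases ht.1.eq_or_lt with rfl | hμt
  · have hd : binRelEntropy (μ / γ) (μ / γ) = 0 := by
      have h1 : μ / γ < 1 := (div_lt_one hγ).2 htγ
      rw [binRelEntropy, div_self (div_pos hμ0 hγ).ne', div_self (sub_pos.2 h1).ne']
      simp
    rw [hd, mul_zero, exp_zero]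
    have hlt := measureReal_mul_lt_integral (K := μ) hA hA0
      ((integrable_finsetSum _ fun i _ => hfi i).const_mul (1 / (M : ℝ)))
      (by
        filter_upwards [hall] with ω hω
        exact mul_nonneg (by positivity) (Finset.sum_nonneg fun i _ => (hω i).1))
      (ae_of_all _ fun ω hω => hω)
    have hmean : ∀ i, ∫ ω, f i ω ∂P ≤ μ := fun i => by
      simpa using integral_mul_le_of_condExp_le (Y := fun _ => 1)
        (iSup₂_le fun j _ => (hX j).comap_le) stronglyMeasurable_const
        (ae_of_all _ fun _ => zero_le_one) (integrable_const 1) (hfi i)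
        (by simpa using hfi i) (hcond i)
    have hle : ∫ ω, (1 / (M : ℝ)) * ∑ i, f i ω ∂P ≤ μ := by
      rw [integral_const_mul, integral_finsetSum _ fun i _ => hfi i, one_div,
        inv_mul_le_iff₀ hM']
      calc ∑ i, ∫ ω, f i ω ∂P ≤ ∑ _i : Fin M, μ := Finset.sum_le_sum fun i _ => hmean i
        _ = M * μ := by simp
    nlinarith
  have hp : 0 < μ / γ := div_pos hμ0 hγ
  have hpa : μ / γ < t / γ := by gcongr
  have ha : t / γ < 1 := (div_lt_one hγ).2 htγ
  rw [← one_add_mul_pow_div_rpow_eq_exp_binRelEntropy hp hpa.le ha]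
  set p := μ / γ with hp_def
  set a := t / γ with ha_def
  set r := a * (1 - p) / (p * (1 - a))
  have hr : 1 < r := by
    rw [one_lt_div (mul_pos hp (sub_pos.2 ha))]
    linarith
  have hr0 : 0 < r := zero_lt_one.trans hr
  have hc : 0 ≤ (r - 1) / γ := div_nonneg (sub_pos.2 hr).le hγ.le
  obtain ⟨hint, hle⟩ := integral_prod_one_add_mul_le P X hX hμ0.le hc f hmeas hbd hcond M le_rfl
  have huniv : (Finset.univ.filter fun i : Fin M => i.val < M) = Finset.univ :=
    Finset.filter_true_of_mem fun i _ => i.isLt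
  simp only [huniv] at hint hle
  rw [lt_div_iff₀ (rpow_pos_of_pos hr0 _)]
  refine (measureReal_mul_lt_integral hA hA0 hint ?_ ?_).trans_le (hle.trans_eq ?_)
  · filter_upwards [hall] with ω hω
    exact Finset.prod_nonneg fun i _ => add_nonneg zero_le_one (mul_nonneg hc (hω i).1)
  · filter_upwards [hall] with ω hω hωA
    have hsum : a * M < ∑ i, f i ω / γ := by
      have h : t < (1 / (M : ℝ)) * ∑ i, f i ω := hωA
      rw [one_div, lt_inv_mul_iff₀ hM'] at h
      rw [← Finset.sum_div, ha_def, lt_div_iff₀ hγ]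
      calc t / γ * M * γ = M * t := by field_simp
        _ < _ := h
    calc r ^ (a * M) < r ^ (∑ i, f i ω / γ) := rpow_lt_rpow_of_exponent_lt hr hsum
      _ = ∏ i, r ^ (f i ω / γ) := rpow_sum_of_pos hr0 _ _
      _ ≤ ∏ i, (1 + (r - 1) / γ * f i ω) := by
        refine Finset.prod_le_prod (fun i _ => (rpow_pos_of_pos hr0 _).le) fun i _ => ?_
        have hbern := rpow_one_add_le_one_add_mul_self (s := r - 1) (p := f i ω / γ)
          (by linarith) (div_nonneg (hω i).1 hγ.le) ((div_le_one hγ).2 (hω i).2)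
        calc r ^ (f i ω / γ) = (1 + (r - 1)) ^ (f i ω / γ) := by rw [add_sub_cancel]
          _ ≤ _ := hbern
          _ = _ := by ring
  · rw [hp_def]
    ring
end

section
/- Let (Ω,𝔉,ℙ) be a probability space, M a positive integer, and X_1,…,X_M random variables with X_i taking values in a measurable space E_i. Let μ ∈ [0,1], and for each i ∈ {1,…,M} let f_i : E_1×⋯×E_i → ℝ be measurable with 0 ≤ f_i(X_1,…,X_i) ≤ 1 almost surely and 𝔼[f_i(X_1,…,X_i) | X_1,…,X_{i−1}] ≤ μ almost surely. Then for every λ > 0, 𝔼[ exp( λ·Σ_{i=1}^M f_i(X_1,…,X_i) ) ] ≤ (1 + (e^λ − 1)·μ)^M. -/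
open MeasureTheory ProbabilityTheory Real

/-- The chord bound for the exponential: `e^{lu} ≤ 1 + (e^l - 1)u` on `[0,1]`. -/
lemma exp_mul_le_chord (l : ℝ) {u : ℝ} (hu : u ∈ Set.Icc (0 : ℝ) 1) :
    exp (l * u) ≤ 1 + (exp l - 1) * u := by
  have h := convexOn_exp.2 (Set.mem_univ 0) (Set.mem_univ l) (sub_nonneg.2 hu.2) hu.1
    (sub_add_cancel 1 u)
  simp only [smul_eq_mul, mul_zero, zero_add, exp_zero, mul_one] at h
  rw [mul_comm l u]
  linarith

/-- Conditioning on a σ-algebra `m`, a factor `e^{lg}` with `g ∈ [0,1]` and `P[g | m] ≤ μ`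
multiplied by a bounded nonnegative `m`-measurable function `G` contributes at most
`1 + (e^l - 1)μ`. -/
lemma integral_mul_exp_le_of_condExp_le {Ω : Type*} {m mΩ : MeasurableSpace Ω} (hm : m ≤ mΩ)
    {P : Measure Ω} [IsFiniteMeasure P] {G g : Ω → ℝ} {μ l c : ℝ} (hl : 0 ≤ l)
    (hG : Measurable[m] G) (hG0 : ∀ ω, 0 ≤ G ω) (hGc : ∀ᵐ ω ∂P, G ω ≤ c)
    (hg : Measurable g) (hg01 : ∀ᵐ ω ∂P, g ω ∈ Set.Icc (0 : ℝ) 1)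
    (hcond : ∀ᵐ ω ∂P, (P[g | m]) ω ≤ μ) :
    ∫ ω, G ω * exp (l * g ω) ∂P ≤ (1 + (exp l - 1) * μ) * ∫ ω, G ω ∂P := by
  have hGbound : ∀ᵐ ω ∂P, ‖G ω‖ ≤ c := by
    filter_upwards [hGc] with ω h
    rwa [norm_of_nonneg (hG0 ω)]
  have hGint : Integrable G P := .of_bound (hG.mono hm le_rfl).aestronglyMeasurable c hGbound
  have hgint : Integrable g P := by
    refine .of_bound hg.aestronglyMeasurable 1 ?_
    filter_upwards [hg01] with ω h
    rw [norm_of_nonneg h.1]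
    exact h.2
  have hGg : Integrable (G * g) P :=
    hgint.bdd_mul (hG.mono hm le_rfl).aestronglyMeasurable hGbound
  have hpull : ∫ ω, (G * g) ω ∂P ≤ μ * ∫ ω, G ω ∂P := by
    rw [← integral_condExp hm, ← integral_const_mul]
    refine integral_mono_ae integrable_condExp (hGint.const_mul μ) ?_
    filter_upwards [condExp_stronglyMeasurable_mul_of_bound hm hG.stronglyMeasurable hgint c
      hGbound, hcond] with ω h₁ h₂
    rw [h₁, Pi.mul_apply, mul_comm]
    exact mul_le_mul_of_nonneg_right h₂ (hG0 ω)
  calc ∫ ω, G ω * exp (l * g ω) ∂P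
      ≤ ∫ ω, (G ω + (exp l - 1) * (G * g) ω) ∂P := by
        refine integral_mono_of_nonneg (.of_forall fun ω => mul_nonneg (hG0 ω) (exp_pos _).le)
          (hGint.add (hGg.const_mul _)) ?_
        filter_upwards [hg01] with ω h
        have := mul_le_mul_of_nonneg_left (exp_mul_le_chord l h) (hG0 ω)
        simp only [Pi.mul_apply]
        linarith
    _ = ∫ ω, G ω ∂P + (exp l - 1) * ∫ ω, (G * g) ω ∂P := by
        rw [integral_add hGint (hGg.const_mul _), integral_const_mul]
    _ ≤ (1 + (exp l - 1) * μ) * ∫ ω, G ω ∂P := by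
        have := mul_le_mul_of_nonneg_left hpull (sub_nonneg.2 (one_le_exp hl))
        linarith

/-- **Moment-generating-function bound** underlying the Chernoff-type inequality for
random variables whose conditional expectation given the past is uniformly bounded
by `μ`.  With `f i` playing the role of `f_i(X_1,…,X_i)` (measurable w.r.t. the
σ-algebra generated by `X_0,…,X_i`, valued in `[0,1]` a.s., conditional mean given
the past at most `μ` a.s.), for every `λ > 0`,
`𝔼[exp(λ Σᵢ fᵢ)] ≤ (1 + (e^λ - 1)μ)^M`. -/
theorem mgf_bounded_condexp
    {Ω : Type*} [MeasurableSpace Ω] (P : Measure Ω) [IsProbabilityMeasure P]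
    {M : ℕ} (hM : 0 < M)
    {E : Fin M → Type*} [∀ i, MeasurableSpace (E i)]
    (X : ∀ i, Ω → E i) (hX : ∀ i, Measurable (X i))
    (μ : ℝ) (hμ0 : 0 ≤ μ) (hμ1 : μ ≤ 1)
    (f : Fin M → Ω → ℝ)
    (hmeas : ∀ i : Fin M,
      Measurable[⨆ j : Fin M, ⨆ _ : j ≤ i, MeasurableSpace.comap (X j) inferInstance] (f i))
    (hbd : ∀ i : Fin M, ∀ᵐ ω ∂P, f i ω ∈ Set.Icc (0 : ℝ) 1)
    (hcond : ∀ i : Fin M, ∀ᵐ ω ∂P,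
      (P[f i | ⨆ j : Fin M, ⨆ _ : j < i, MeasurableSpace.comap (X j) inferInstance]) ω ≤ μ)
    (l : ℝ) (hl : 0 < l) :
    ∫ ω, Real.exp (l * ∑ i, f i ω) ∂P ≤ (1 + (Real.exp l - 1) * μ) ^ M := by
  have hle : ∀ p : Fin M → Prop,
      (⨆ j : Fin M, ⨆ _ : p j, MeasurableSpace.comap (X j) inferInstance) ≤ ‹MeasurableSpace Ω› :=
    fun p => iSup₂_le fun j _ => (hX j).comap_le
  suffices h : ∀ n ≤ M, ∫ ω, exp (l * ∑ i with i.val < n, f i ω) ∂P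
      ≤ (1 + (exp l - 1) * μ) ^ n by
    simpa using h M le_rfl
  intro n
  induction n with
  | zero => simp
  | succ n ih =>
    intro hn
    let k : Fin M := ⟨n, hn⟩
    have hsplit : (Finset.univ.filter fun i : Fin M => i.val < n + 1)
        = insert k (Finset.univ.filter fun i : Fin M => i.val < n) := by
      ext i
      simp [k, Fin.ext_iff]
      omega
    have hsum : ∀ ω, exp (l * ∑ i with i.val < n + 1, f i ω)
        = exp (l * ∑ i with i.val < n, f i ω) * exp (l * f k ω) := fun ω => by
      rw [hsplit, Finset.sum_insert (by simp [k]), ← exp_add]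
      ring_nf
    have hpast : Measurable[⨆ j : Fin M, ⨆ _ : j < k, MeasurableSpace.comap (X j) inferInstance]
        fun ω => exp (l * ∑ i with i.val < n, f i ω) := by
      refine measurable_exp.comp (Measurable.const_mul (Finset.measurable_fun_sum _ ?_) l)
      intro i hi
      have hik : i < k := by simpa [k, Fin.lt_def] using hi
      exact (hmeas i).mono (biSup_mono fun j hj => lt_of_le_of_lt hj hik) le_rfl
    have hbound : ∀ᵐ ω ∂P, exp (l * ∑ i with i.val < n, f i ω) ≤ exp (l * M) := by
      filter_upwards [ae_all_iff.2 hbd] with ω h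
      gcongr
      calc ∑ i with i.val < n, f i ω ≤ ∑ i, f i ω :=
            Finset.sum_le_univ_sum_of_nonneg fun i => (h i).1
        _ ≤ ∑ _i : Fin M, (1 : ℝ) := Finset.sum_le_sum fun i _ => (h i).2
        _ = M := by simp
    simp only [hsum]
    calc _ ≤ (1 + (exp l - 1) * μ) * ∫ ω, exp (l * ∑ i with i.val < n, f i ω) ∂P :=
          integral_mul_exp_le_of_condExp_le (hle (· < k)) hl.le hpast (fun _ => (exp_pos _).le)
            hbound ((hmeas k).mono (hle (· ≤ k)) le_rfl) (hbd k) (hcond k)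
      _ ≤ (1 + (exp l - 1) * μ) ^ (n + 1) := by
          rw [pow_succ']
          have := sub_nonneg.2 (one_le_exp hl.le)
          exact mul_le_mul_of_nonneg_left (ih (by omega)) (by positivity)
end

section
/- Let 0 < μ < 1 and μ ≤ t ≤ 1. Then sup_{λ > 0} [ λ·t − ln(1 + (e^λ − 1)·μ) ] = d(t,μ), where d is the binary relative entropy in nats. -/
open Real

/-- The argument of the logarithm, the moment generating function of a Bernoulli variable,
is positive. -/
lemma bernoulli_mgf_pos {μ : ℝ} (hμ0 : 0 < μ) (hμ1 : μ < 1) (l : ℝ) :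
    0 < 1 + (Real.exp l - 1) * μ := by
  nlinarith [mul_pos (Real.exp_pos l) hμ0]

/-- Tangent-line bound for `a * log (a / b)`. -/
lemma mul_log_add_sub_le_mul_log_div {a b c : ℝ} (ha : 0 ≤ a) (hb : 0 < b) (hc : 0 < c) :
    a * Real.log c + a - b * c ≤ a * Real.log (a / b) := by
  rcases ha.eq_or_lt with rfl | ha
  · simp [(mul_pos hb hc).le]
  · have h := Real.log_le_sub_one_of_pos (div_pos (mul_pos hb hc) ha)
    rw [Real.log_div (mul_pos hb hc).ne' ha.ne', Real.log_mul hb.ne' hc.ne'] at h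
    rw [Real.log_div ha.ne' hb.ne']
    have h' := mul_le_mul_of_nonneg_left h ha.le
    have e : a * (b * c / a - 1) = b * c - a := by field_simp
    linarith

lemma cgf_le_binRelEntropy {μ t : ℝ} (hμ0 : 0 < μ) (hμ1 : μ < 1) (ht0 : 0 ≤ t) (ht1 : t ≤ 1)
    (l : ℝ) : l * t - Real.log (1 + (Real.exp l - 1) * μ) ≤ binRelEntropy t μ := by
  have hM := bernoulli_mgf_pos hμ0 hμ1 l
  set M := 1 + (Real.exp l - 1) * μ with hMdef
  have h₁ := mul_log_add_sub_le_mul_log_div ht0 hμ0 (div_pos (Real.exp_pos l) hM)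
  have h₂ := mul_log_add_sub_le_mul_log_div (sub_nonneg.2 ht1) (sub_pos.2 hμ1) (inv_pos.2 hM)
  rw [Real.log_div (Real.exp_pos l).ne' hM.ne', Real.log_exp] at h₁
  rw [Real.log_inv] at h₂
  have e : μ * (Real.exp l / M) + (1 - μ) * M⁻¹ = 1 := by
    field_simp
    rw [hMdef]
    ring
  unfold binRelEntropy
  linarith

/-- The tilt at which the tilted Bernoulli variable has mean `t`. -/
lemma cgf_log_odds_eq_binRelEntropy {μ t : ℝ} (hμ0 : 0 < μ) (hμ1 : μ < 1) (ht0 : 0 < t)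
    (ht1 : t < 1) :
    Real.log (t * (1 - μ) / (μ * (1 - t))) * t -
      Real.log (1 + (Real.exp (Real.log (t * (1 - μ) / (μ * (1 - t)))) - 1) * μ) =
      binRelEntropy t μ := by
  have h₁ : 0 < 1 - μ := sub_pos.2 hμ1
  have h₂ : 0 < 1 - t := sub_pos.2 ht1
  rw [Real.exp_log (by positivity)]
  have e : 1 + (t * (1 - μ) / (μ * (1 - t)) - 1) * μ = (1 - μ) / (1 - t) := by
    field_simp
    ring
  rw [e, binRelEntropy, Real.log_div (by positivity) (by positivity),
    Real.log_mul ht0.ne' h₁.ne', Real.log_mul hμ0.ne' h₂.ne', Real.log_div h₁.ne' h₂.ne',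
    Real.log_div ht0.ne' hμ0.ne', Real.log_div h₂.ne' h₁.ne']
  ring

lemma tendsto_cgf_one_atTop {μ : ℝ} (hμ0 : 0 < μ) (hμ1 : μ < 1) :
    Filter.Tendsto (fun l : ℝ => l * 1 - Real.log (1 + (Real.exp l - 1) * μ)) Filter.atTop
      (nhds (binRelEntropy 1 μ)) := by
  have hlim : Filter.Tendsto (fun l : ℝ => -Real.log (Real.exp (-l) * (1 - μ) + μ)) Filter.atTop
      (nhds (-Real.log (0 * (1 - μ) + μ))) :=
    (((Real.tendsto_exp_neg_atTop_nhds_zero.mul_const _).add_const _).log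
      (by simpa using hμ0.ne')).neg
  have hval : binRelEntropy 1 μ = -Real.log (0 * (1 - μ) + μ) := by
    simp [binRelEntropy]
  rw [hval]
  refine hlim.congr fun l => ?_
  have hpos : 0 < Real.exp (-l) * (1 - μ) + μ :=
    add_pos (mul_pos (Real.exp_pos _) (sub_pos.2 hμ1)) hμ0
  have e : 1 + (Real.exp l - 1) * μ = Real.exp l * (Real.exp (-l) * (1 - μ) + μ) := by
    rw [mul_add, ← mul_assoc, ← Real.exp_add, add_neg_cancel, Real.exp_zero]
    ring
  rw [e, Real.log_mul (Real.exp_pos l).ne' hpos.ne', Real.log_exp]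
  ring

/-- **Variational formula for the binary relative entropy**: for `0 < μ < 1` and
`μ ≤ t ≤ 1`, `sup_{λ > 0} [λt − ln(1 + (e^λ − 1)μ)] = d(t,μ)`. -/
theorem sup_cgf_eq_binRelEntropy (μ t : ℝ) (hμ0 : 0 < μ) (hμ1 : μ < 1)
    (hμt : μ ≤ t) (ht1 : t ≤ 1) :
    sSup ((fun l : ℝ => l * t - Real.log (1 + (Real.exp l - 1) * μ)) '' Set.Ioi (0 : ℝ)) =
      binRelEntropy t μ := by
  have hlub : IsLUB
      ((fun l : ℝ => l * t - Real.log (1 + (Real.exp l - 1) * μ)) '' Set.Ioi (0 : ℝ))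
      (binRelEntropy t μ) := by
    refine isLUB_of_mem_closure ?_ ?_
    · rintro _ ⟨l, -, rfl⟩
      exact cgf_le_binRelEntropy hμ0 hμ1 (hμ0.le.trans hμt) ht1 l
    · have ht0 : 0 < t := hμ0.trans_le hμt
      rcases ht1.eq_or_lt with rfl | ht1
      · exact mem_closure_of_tendsto (tendsto_cgf_one_atTop hμ0 hμ1)
          ((Filter.eventually_gt_atTop 0).mono fun l hl => Set.mem_image_of_mem _ hl)
      · rw [← cgf_log_odds_eq_binRelEntropy hμ0 hμ1 ht0 ht1]
        refine mem_closure_image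
          (f := fun l : ℝ => l * t - Real.log (1 + (Real.exp l - 1) * μ)) ?_ ?_
        · exact (Continuous.sub (by fun_prop) (Continuous.log (by fun_prop)
            fun l => (bernoulli_mgf_pos hμ0 hμ1 l).ne')).continuousAt
        · rw [closure_Ioi]
          refine Real.log_nonneg ?_
          rw [one_le_div (mul_pos hμ0 (sub_pos.2 ht1))]
          linarith
  exact hlub.csSup_eq (Set.nonempty_Ioi.image _)
end

section
/- Let 𝒳, 𝒮, 𝒴 be finite nonempty sets, W a channel assigning to each (x,s) ∈ 𝒳×𝒮 a probability mass function W(·|x,s) on 𝒴, ℓ : 𝒮 → ℝ a cost function, Λ ∈ ℝ, and let P_X be a probability distribution on 𝒳 with P_X(x) > 0 for all x ∈ 𝒳. For η ≥ 0 let 𝒟_η denote the set of joint probability mass functions Q_{XX'SY} on 𝒳×𝒳×𝒮×𝒴 whose S-marginal Q_S satisfies Σ_s Q_S(s)ℓ(s) ≤ Λ and whose Kullback–Leibler divergence from the distribution (x,x',s,y) ↦ P_X(x)·Q_{X'S}(x',s)·W(y|x,s) is at most η, where Q_{X'S} is the (X',S)-marginal of Q_{XX'SY}. Let η* = inf{ η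 ≥ 0 : there exists a joint probability mass function Q_{XX'SS'Y} on 𝒳×𝒳×𝒮×𝒮×𝒴 whose (X,X',S,Y)-marginal lies in 𝒟_η and whose (X',X,S',Y)-marginal lies in 𝒟_η }. If Λ₀(P_X) > Λ, then η* > 0. -/
open Real
open scoped ENNReal

noncomputable section

/-- The probability simplex on a finite alphabet `Z`. -/
def simplex (Z : Type*) [Fintype Z] : Set (Z → ℝ) :=
  {p | (∀ z, 0 ≤ p z) ∧ ∑ z, p z = 1}

/-- Conditional distributions `P_{S|X}` satisfying the symmetrizing condition
`Σ_s P_{S|X}(s|x) W(y|x',s) = Σ_s P_{S|X}(s|x') W(y|x,s)` for all `y` and all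
`x, x'` with `P_X(x), P_X(x') > 0`. -/
def symmetrizers {𝒳 𝒮 𝒴 : Type*} [Fintype 𝒳] [Fintype 𝒮] [Fintype 𝒴]
    (W : 𝒳 → 𝒮 → 𝒴 → ℝ) (P_X : 𝒳 → ℝ) : Set (𝒳 → 𝒮 → ℝ) :=
  {P | (∀ x, P x ∈ simplex 𝒮) ∧
    ∀ y x x', 0 < P_X x → 0 < P_X x' →
      ∑ s, P x s * W x' s y = ∑ s, P x' s * W x s y}

/-- The symmetrizability cost threshold `Λ₀(P_X)`: the infimum of
`Σ_{x,s} P_X(x) P_{S|X}(s|x) ℓ(s)` over symmetrizing conditional distributions,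
`+∞` (in `EReal`) if none exists. -/
def Lambda0 {𝒳 𝒮 𝒴 : Type*} [Fintype 𝒳] [Fintype 𝒮] [Fintype 𝒴]
    (W : 𝒳 → 𝒮 → 𝒴 → ℝ) (ℓ : 𝒮 → ℝ) (P_X : 𝒳 → ℝ) : EReal :=
  sInf ((fun P : 𝒳 → 𝒮 → ℝ => ((∑ x, ∑ s, P_X x * P x s * ℓ s : ℝ) : EReal)) ''
    symmetrizers W P_X)

/-- Kullback–Leibler divergence (base 2) between two pmfs on a finite alphabet,
`+∞` if `Q` is not absolutely continuous with respect to `R`. -/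
def klDiv {Z : Type*} [Fintype Z] (Q R : Z → ℝ) : ℝ≥0∞ :=
  if ∀ z, R z = 0 → Q z = 0
  then ENNReal.ofReal (∑ z, Q z * Real.logb 2 (Q z / R z))
  else ⊤

/-- The set `𝒟_η` of joint pmfs `Q_{XX'SY}` whose `S`-marginal has `ℓ`-cost at most `Λ`
and whose KL divergence from `P_X × Q_{X'S} × W` is at most `η`. -/
def Dset {𝒳 𝒮 𝒴 : Type*} [Fintype 𝒳] [Fintype 𝒮] [Fintype 𝒴]
    (W : 𝒳 → 𝒮 → 𝒴 → ℝ) (ℓ : 𝒮 → ℝ) (Λ : ℝ) (P_X : 𝒳 → ℝ) (η : ℝ≥0∞) :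
    Set (𝒳 × 𝒳 × 𝒮 × 𝒴 → ℝ) :=
  {Q | Q ∈ simplex (𝒳 × 𝒳 × 𝒮 × 𝒴) ∧
    (∑ s, (∑ x, ∑ x', ∑ y, Q (x, x', s, y)) * ℓ s) ≤ Λ ∧
    klDiv Q (fun p =>
      P_X p.1 * (∑ x, ∑ y, Q (x, p.2.1, p.2.2.1, y)) *
        W p.1 p.2.2.1 p.2.2.2) ≤ η}

/-- The squared Hellinger distance between two nonnegative functions on a finite alphabet. -/
def hellingerSq {Z : Type*} [Fintype Z] (Q R : Z → ℝ) : ℝ :=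
  ∑ z, (√(Q z) - √(R z)) ^ 2

theorem hellingerSq_nonneg {Z : Type*} [Fintype Z] (Q R : Z → ℝ) : 0 ≤ hellingerSq Q R :=
  Finset.sum_nonneg fun _ _ => sq_nonneg _

theorem eq_of_hellingerSq_eq_zero {Z : Type*} [Fintype Z] {Q R : Z → ℝ}
    (hQ : ∀ z, 0 ≤ Q z) (hR : ∀ z, 0 ≤ R z) (h : hellingerSq Q R = 0) (z : Z) : Q z = R z := by
  have hz := (Finset.sum_eq_zero_iff_of_nonneg fun _ _ => sq_nonneg _).1 h z (Finset.mem_univ z)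
  exact (Real.sqrt_inj (hQ z) (hR z)).1 (sub_eq_zero.1 (pow_eq_zero_iff two_ne_zero |>.1 hz))

theorem two_mul_sub_sqrt_mul_sqrt_le_mul_log {q r : ℝ} (hq : 0 ≤ q) (hr : 0 ≤ r)
    (hqr : r = 0 → q = 0) : 2 * q - 2 * (√q * √r) ≤ q * Real.log (q / r) := by
  rcases hq.eq_or_lt with rfl | hq'
  · simp
  have hr' : 0 < r := hr.lt_of_ne fun h => hq'.ne' (hqr h.symm)
  have hsq := Real.sqrt_pos.2 hq'
  have hsr := Real.sqrt_pos.2 hr'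
  have hlog : Real.log (q / r) = -(2 * Real.log (√r / √q)) := by
    rw [Real.log_div hq'.ne' hr'.ne', Real.log_div hsr.ne' hsq.ne', Real.log_sqrt hr,
      Real.log_sqrt hq]
    ring
  have hbound := Real.log_le_sub_one_of_pos (div_pos hsr hsq)
  have hmul : q * (√r / √q) = √q * √r := by
    nth_rewrite 1 [← Real.mul_self_sqrt hq]
    field_simp
  rw [hlog]
  nlinarith [mul_le_mul_of_nonneg_left hbound hq]

theorem ofReal_hellingerSq_le_klDiv {Z : Type*} [Fintype Z] {Q R : Z → ℝ}
    (hQ : Q ∈ simplex Z) (hR : ∀ z, 0 ≤ R z) (hR1 : ∑ z, R z ≤ 1) :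
    ENNReal.ofReal (hellingerSq Q R) ≤ klDiv Q R := by
  unfold klDiv
  split_ifs with hac
  swap
  · exact le_top
  apply ENNReal.ofReal_le_ofReal
  have hH : hellingerSq Q R ≤ ∑ z, Q z * Real.log (Q z / R z) := by
    have hexp : hellingerSq Q R = ∑ z, (2 * Q z - 2 * (√(Q z) * √(R z))) + (∑ z, R z - 1) := by
      rw [← hQ.2, ← Finset.sum_sub_distrib, ← Finset.sum_add_distrib]
      refine Finset.sum_congr rfl fun z _ => ?_
      rw [sub_sq, Real.sq_sqrt (hQ.1 z), Real.sq_sqrt (hR z)]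
      ring
    have hle := Finset.sum_le_sum fun z (_ : z ∈ Finset.univ) =>
      two_mul_sub_sqrt_mul_sqrt_le_mul_log (hQ.1 z) (hR z) (hac z)
    linarith
  have hlogb : ∑ z, Q z * Real.logb 2 (Q z / R z) =
      (∑ z, Q z * Real.log (Q z / R z)) / Real.log 2 := by
    rw [Finset.sum_div]
    exact Finset.sum_congr rfl fun z _ => by rw [Real.logb, mul_div_assoc]
  have hlog2 : Real.log 2 ≤ 1 := by linarith [Real.log_two_lt_d9]
  rw [hlogb]
  exact hH.trans
    (le_div_self ((hellingerSq_nonneg Q R).trans hH) (Real.log_pos one_lt_two) hlog2)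

theorem isCompact_simplex (Z : Type*) [Fintype Z] : IsCompact (simplex Z) := by
  have h : simplex Z = stdSimplex ℝ Z := rfl
  rw [h]
  exact isCompact_stdSimplex ℝ Z

section

variable {𝒳 𝒮 𝒴 : Type*} [Fintype 𝒳] [Fintype 𝒴]

/-- The `(X', S)`-marginal of a joint pmf on `𝒳 × 𝒳 × 𝒮 × 𝒴`. -/
def inputStateMarginal (Q : 𝒳 × 𝒳 × 𝒮 × 𝒴 → ℝ) (x' : 𝒳) (s : 𝒮) : ℝ :=
  ∑ x, ∑ y, Q (x, x', s, y)

theorem inputStateMarginal_nonneg {Q : 𝒳 × 𝒳 × 𝒮 × 𝒴 → ℝ} (hQ : ∀ z, 0 ≤ Q z)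
    (x' : 𝒳) (s : 𝒮) : 0 ≤ inputStateMarginal Q x' s :=
  Finset.sum_nonneg fun _ _ => Finset.sum_nonneg fun _ _ => hQ _

variable [Fintype 𝒮]

/-- The reference distribution `P_X × Q_{X'S} × W`. -/
def referenceDist (W : 𝒳 → 𝒮 → 𝒴 → ℝ) (P_X : 𝒳 → ℝ) (Q : 𝒳 × 𝒳 × 𝒮 × 𝒴 → ℝ) :
    𝒳 × 𝒳 × 𝒮 × 𝒴 → ℝ :=
  fun p => P_X p.1 * inputStateMarginal Q p.2.1 p.2.2.1 * W p.1 p.2.2.1 p.2.2.2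

/-- The expected `ℓ`-cost of the `S`-marginal. -/
def stateCost (ℓ : 𝒮 → ℝ) (Q : 𝒳 × 𝒳 × 𝒮 × 𝒴 → ℝ) : ℝ :=
  ∑ s, (∑ x, ∑ x', ∑ y, Q (x, x', s, y)) * ℓ s

theorem sum_inputStateMarginal (Q : 𝒳 × 𝒳 × 𝒮 × 𝒴 → ℝ) :
    ∑ x', ∑ s, inputStateMarginal Q x' s = ∑ z, Q z := by
  simp only [Fintype.sum_prod_type, inputStateMarginal]
  rw [Finset.sum_comm (γ := 𝒳) (s := (Finset.univ : Finset 𝒳))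
    (f := fun x x' => ∑ s, ∑ y, Q (x, x', s, y))]
  exact Finset.sum_congr rfl fun x' _ => Finset.sum_comm

theorem stateCost_eq (ℓ : 𝒮 → ℝ) (Q : 𝒳 × 𝒳 × 𝒮 × 𝒴 → ℝ) :
    stateCost ℓ Q = ∑ x, ∑ s, inputStateMarginal Q x s * ℓ s := by
  rw [Finset.sum_comm]
  refine Finset.sum_congr rfl fun s _ => ?_
  rw [← Finset.sum_mul, Finset.sum_comm]
  rfl

theorem sum_referenceDist_fst {W : 𝒳 → 𝒮 → 𝒴 → ℝ} (hW : ∀ x s, W x s ∈ simplex 𝒴)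
    (P_X : 𝒳 → ℝ) {Q : 𝒳 × 𝒳 × 𝒮 × 𝒴 → ℝ} (hQ : Q ∈ simplex (𝒳 × 𝒳 × 𝒮 × 𝒴)) (x : 𝒳) :
    ∑ x', ∑ s, ∑ y, referenceDist W P_X Q (x, x', s, y) = P_X x := by
  simp only [referenceDist, ← Finset.mul_sum, (hW _ _).2, mul_one, sum_inputStateMarginal, hQ.2]

theorem ofReal_hellingerSq_le_of_mem_Dset {W : 𝒳 → 𝒮 → 𝒴 → ℝ}
    (hW : ∀ x s, W x s ∈ simplex 𝒴) {ℓ : 𝒮 → ℝ} {Λ : ℝ} {P_X : 𝒳 → ℝ} (hP : P_X ∈ simplex 𝒳)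
    {η : ℝ≥0∞} {Q : 𝒳 × 𝒳 × 𝒮 × 𝒴 → ℝ} (hQ : Q ∈ Dset W ℓ Λ P_X η) :
    ENNReal.ofReal (hellingerSq Q (referenceDist W P_X Q)) ≤ η := by
  refine le_trans (ofReal_hellingerSq_le_klDiv hQ.1 (fun p => ?_) ?_) hQ.2.2
  · exact mul_nonneg (mul_nonneg (hP.1 _) (inputStateMarginal_nonneg hQ.1.1 _ _)) ((hW _ _).1 _)
  · simp only [Fintype.sum_prod_type, sum_referenceDist_fst hW P_X hQ.1, hP.2, le_refl]

/-- Two families of state distributions that induce the same output law average to a symmetrizer. -/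
theorem Lambda0_le_of_exchange {W : 𝒳 → 𝒮 → 𝒴 → ℝ} {ℓ : 𝒮 → ℝ} {Λ : ℝ} {P_X : 𝒳 → ℝ}
    (hPpos : ∀ x, 0 < P_X x) {M N : 𝒳 → 𝒮 → ℝ}
    (hM : ∀ x s, 0 ≤ M x s) (hN : ∀ x s, 0 ≤ N x s)
    (hMP : ∀ x, ∑ s, M x s = P_X x) (hNP : ∀ x, ∑ s, N x s = P_X x)
    (hMN : ∀ x x' y, ∑ s, P_X x * M x' s * W x s y = ∑ s, P_X x' * N x s * W x' s y)
    (hMΛ : ∑ x, ∑ s, M x s * ℓ s ≤ Λ) (hNΛ : ∑ x, ∑ s, N x s * ℓ s ≤ Λ) :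
    Lambda0 W ℓ P_X ≤ Λ := by
  have hmem : (fun x s => (M x s + N x s) / (2 * P_X x)) ∈ symmetrizers W P_X := by
    refine ⟨fun x => ⟨fun s => ?_, ?_⟩, fun y x x' _ _ => ?_⟩
    · exact div_nonneg (add_nonneg (hM x s) (hN x s)) (by linarith [hPpos x])
    · have := (hPpos x).ne'
      rw [← Finset.sum_div, Finset.sum_add_distrib, hMP, hNP]
      field_simp
      norm_num
    · have hx := (hPpos x).ne'
      have hx' := (hPpos x').ne'
      have hsplit : ∀ a b, P_X a ≠ 0 → P_X b ≠ 0 →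
          ∑ s, (M a s + N a s) / (2 * P_X a) * W b s y =
          (∑ s, P_X b * M a s * W b s y + ∑ s, P_X b * N a s * W b s y) /
            (2 * P_X a * P_X b) := by
        intro a b ha hb
        rw [← Finset.sum_add_distrib, Finset.sum_div]
        refine Finset.sum_congr rfl fun s _ => ?_
        field_simp
      rw [hsplit x x' hx hx', hsplit x' x hx' hx, hMN x' x y, ← hMN x x' y]
      ring
  have hcost : ∑ x, ∑ s, P_X x * ((M x s + N x s) / (2 * P_X x)) * ℓ s ≤ Λ := by
    have hterm : ∑ x, ∑ s, P_X x * ((M x s + N x s) / (2 * P_X x)) * ℓ s =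
        (∑ x, ∑ s, M x s * ℓ s + ∑ x, ∑ s, N x s * ℓ s) / 2 := by
      simp only [← Finset.sum_add_distrib, Finset.sum_div]
      refine Finset.sum_congr rfl fun x _ => Finset.sum_congr rfl fun s _ => ?_
      have := (hPpos x).ne'
      field_simp
    linarith
  exact (sInf_le (Set.mem_image_of_mem _ hmem)).trans (EReal.coe_le_coe_iff.2 hcost)

theorem Lambda0_le_of_eq_referenceDist {W : 𝒳 → 𝒮 → 𝒴 → ℝ}
    (hW : ∀ x s, W x s ∈ simplex 𝒴) {ℓ : 𝒮 → ℝ} {Λ : ℝ} {P_X : 𝒳 → ℝ}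
    (hPpos : ∀ x, 0 < P_X x) {Q R : 𝒳 × 𝒳 × 𝒮 × 𝒴 → ℝ}
    (hQ : Q ∈ simplex (𝒳 × 𝒳 × 𝒮 × 𝒴)) (hR : R ∈ simplex (𝒳 × 𝒳 × 𝒮 × 𝒴))
    (hQR : ∀ x x' y, ∑ s, Q (x, x', s, y) = ∑ s, R (x', x, s, y))
    (hQΛ : stateCost ℓ Q ≤ Λ) (hRΛ : stateCost ℓ R ≤ Λ)
    (hQref : ∀ z, Q z = referenceDist W P_X Q z) (hRref : ∀ z, R z = referenceDist W P_X R z) :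
    Lambda0 W ℓ P_X ≤ Λ := by
  have hmarg : ∀ {A B : 𝒳 × 𝒳 × 𝒮 × 𝒴 → ℝ}, B ∈ simplex (𝒳 × 𝒳 × 𝒮 × 𝒴) →
      (∀ x x' y, ∑ s, A (x, x', s, y) = ∑ s, B (x', x, s, y)) →
      (∀ z, B z = referenceDist W P_X B z) →
      ∀ x, ∑ s, inputStateMarginal A x s = P_X x := by
    intro A B hB hAB hBref x
    rw [← sum_referenceDist_fst hW P_X hB x]
    simp only [← hBref, inputStateMarginal]
    rw [Finset.sum_comm]
    refine Finset.sum_congr rfl fun x' _ => ?_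
    exact Finset.sum_comm.trans
      ((Finset.sum_congr rfl fun y _ => hAB x' x y).trans Finset.sum_comm)
  refine Lambda0_le_of_exchange hPpos (inputStateMarginal_nonneg hQ.1)
    (inputStateMarginal_nonneg hR.1) (hmarg hR hQR hRref)
    (hmarg hQ (fun x x' y => (hQR x' x y).symm) hQref) (fun x x' y => ?_)
    (stateCost_eq ℓ Q ▸ hQΛ) (stateCost_eq ℓ R ▸ hRΛ)
  have h := hQR x x' y
  simp only [hQref _, hRref _] at h
  exact h

/-- Pairs of joint pmfs within the cost constraint whose `(X, X', Y)`-marginals agree after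
exchanging `X` and `X'`. -/
def exchangeablePairs (ℓ : 𝒮 → ℝ) (Λ : ℝ) :
    Set ((𝒳 × 𝒳 × 𝒮 × 𝒴 → ℝ) × (𝒳 × 𝒳 × 𝒮 × 𝒴 → ℝ)) :=
  (simplex (𝒳 × 𝒳 × 𝒮 × 𝒴) ×ˢ simplex (𝒳 × 𝒳 × 𝒮 × 𝒴)) ∩
    {q | (∀ x x' y, ∑ s, q.1 (x, x', s, y) = ∑ s, q.2 (x', x, s, y)) ∧
      stateCost ℓ q.1 ≤ Λ ∧ stateCost ℓ q.2 ≤ Λ}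

theorem isCompact_exchangeablePairs (ℓ : 𝒮 → ℝ) (Λ : ℝ) :
    IsCompact (exchangeablePairs (𝒳 := 𝒳) (𝒴 := 𝒴) ℓ Λ) := by
  refine ((isCompact_simplex _).prod (isCompact_simplex _)).inter_right ?_
  unfold stateCost
  simp only [Set.ofPred_and, Set.ofPred_forall]
  refine IsClosed.inter ?_ (IsClosed.inter ?_ ?_)
  · exact isClosed_iInter fun x => isClosed_iInter fun x' => isClosed_iInter fun y =>
      isClosed_eq (by fun_prop) (by fun_prop)
  · exact isClosed_le (by fun_prop) (by fun_prop)
  · exact isClosed_le (by fun_prop) (by fun_prop)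

end

/-- **Positivity of the divergence gap `η*` under non-symmetrizability**
(Lemma 3 of the paper).  `η*` is the infimum of those `η` for which some joint pmf
`Q` on `𝒳×𝒳×𝒮×𝒮×𝒴` has its `(X,X',S,Y)`-marginal in `𝒟_η` and its
`(X',X,S',Y)`-marginal in `𝒟_η`.  If `Λ₀(P_X) > Λ` then `η* > 0`. -/
theorem etaStar_pos {𝒳 𝒮 𝒴 : Type*} [Fintype 𝒳] [Fintype 𝒮] [Fintype 𝒴]
    [Nonempty 𝒳] [Nonempty 𝒮] [Nonempty 𝒴]
    (W : 𝒳 → 𝒮 → 𝒴 → ℝ) (hW : ∀ x s, W x s ∈ simplex 𝒴)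
    (ℓ : 𝒮 → ℝ) (Λ : ℝ)
    (P_X : 𝒳 → ℝ) (hP : P_X ∈ simplex 𝒳) (hPpos : ∀ x, 0 < P_X x)
    (hΛ0 : (Λ : EReal) < Lambda0 W ℓ P_X) :
    0 < sInf {η : ℝ≥0∞ |
      ∃ Q : 𝒳 × 𝒳 × 𝒮 × 𝒮 × 𝒴 → ℝ, Q ∈ simplex (𝒳 × 𝒳 × 𝒮 × 𝒮 × 𝒴) ∧
        (fun p : 𝒳 × 𝒳 × 𝒮 × 𝒴 =>
          ∑ s', Q (p.1, p.2.1, p.2.2.1, s', p.2.2.2)) ∈ Dset W ℓ Λ P_X η ∧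
        (fun p : 𝒳 × 𝒳 × 𝒮 × 𝒴 =>
          ∑ s, Q (p.2.1, p.1, s, p.2.2.1, p.2.2.2)) ∈ Dset W ℓ Λ P_X η} := by
  set K := exchangeablePairs (𝒳 := 𝒳) (𝒴 := 𝒴) ℓ Λ
  let F : (𝒳 × 𝒳 × 𝒮 × 𝒴 → ℝ) × (𝒳 × 𝒳 × 𝒮 × 𝒴 → ℝ) → ℝ := fun q =>
    max (hellingerSq q.1 (referenceDist W P_X q.1)) (hellingerSq q.2 (referenceDist W P_X q.2))
  have hF : Continuous F := by
    unfold F hellingerSq referenceDist inputStateMarginal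
    fun_prop
  have hFpos : ∀ q ∈ K, 0 < F q := by
    intro q hq
    by_contra! hle
    obtain ⟨⟨hq₁, hq₂⟩, hex, hc₁, hc₂⟩ := hq
    have href : ∀ {A : 𝒳 × 𝒳 × 𝒮 × 𝒴 → ℝ}, A ∈ simplex (𝒳 × 𝒳 × 𝒮 × 𝒴) →
        hellingerSq A (referenceDist W P_X A) ≤ 0 → ∀ z, A z = referenceDist W P_X A z :=
      fun hA h => eq_of_hellingerSq_eq_zero hA.1
        (fun z => mul_nonneg (mul_nonneg (hP.1 _) (inputStateMarginal_nonneg hA.1 _ _))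
          ((hW _ _).1 _))
        (h.antisymm (hellingerSq_nonneg _ _))
    exact hΛ0.not_ge (Lambda0_le_of_eq_referenceDist hW hPpos hq₁ hq₂ hex hc₁ hc₂
      (href hq₁ ((le_max_left _ _).trans hle)) (href hq₂ ((le_max_right _ _).trans hle)))
  obtain ⟨c, hc, hcF⟩ : ∃ c : ℝ, 0 < c ∧ ∀ q ∈ K, c ≤ F q := by
    rcases K.eq_empty_or_nonempty with hK | hK
    · exact ⟨1, one_pos, by simp [hK]⟩
    · obtain ⟨q, hq, hmin⟩ :=
        (isCompact_exchangeablePairs ℓ Λ).exists_isMinOn hK hF.continuousOn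
      exact ⟨F q, hFpos q hq, fun r hr => hmin hr⟩
  refine (ENNReal.ofReal_pos.2 hc).trans_le (le_sInf ?_)
  rintro η ⟨Q, -, h₁, h₂⟩
  have hmem := hcF (_, _) ⟨⟨h₁.1, h₂.1⟩, fun x x' y => Finset.sum_comm, h₁.2.1, h₂.2.1⟩
  refine (ENNReal.ofReal_le_ofReal hmem).trans ?_
  rw [ENNReal.ofReal_max]
  exact max_le (ofReal_hellingerSq_le_of_mem_Dset hW hP h₁)
    (ofReal_hellingerSq_le_of_mem_Dset hW hP h₂)

end
end

section
/- Let 𝒳, 𝒮, 𝒴 be finite nonempty sets, W a channel assigning to each (x,s) ∈ 𝒳×𝒮 a probability mass function W(·|x,s) on 𝒴, ℓ : 𝒮 → ℝ a cost function, Λ ∈ ℝ, and let P_X be a probability distribution on 𝒳 with P_X(x) > 0 for all x ∈ 𝒳. Suppose there exists a joint probability mass function Q on 𝒳×𝒳×𝒮×𝒮×𝒴, with coordinates (X,X',S,S',Y), such that: (i) Q_{XX'SY}(x,x',s,y) = P_X(x)·Q_{X'S}(x',s)·W(y|x,s) for all x,x',s,y; (ii) Q_{X'XS'Y}(x',x,s',y)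 = P_X(x')·Q_{XS'}(x,s')·W(y|x',s') for all x,x',s',y; and (iii) Σ_s Q_S(s)ℓ(s) ≤ Λ and Σ_{s'} Q_{S'}(s')ℓ(s') ≤ Λ, where subscripts denote the corresponding marginals of Q. Then Λ₀(P_X) ≤ Λ. -/
open Real

noncomputable section

/-- **Core algebraic step of Lemma 3**: if a joint pmf `Q` on `𝒳×𝒳×𝒮×𝒮×𝒴`
(with coordinates `(X,X',S,S',Y)`) satisfies
(i) `Q_{XX'SY}(x,x',s,y) = P_X(x) Q_{X'S}(x',s) W(y|x,s)`,
(ii) `Q_{X'XS'Y}(x',x,s',y) = P_X(x') Q_{XS'}(x,s') W(y|x',s')`, and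
(iii) both state marginals have `ℓ`-cost at most `Λ`,
then `Λ₀(P_X) ≤ Λ`. -/
theorem lambda0_le_of_symmetrizing_joint
    {𝒳 𝒮 𝒴 : Type*} [Fintype 𝒳] [Fintype 𝒮] [Fintype 𝒴]
    [Nonempty 𝒳] [Nonempty 𝒮] [Nonempty 𝒴]
    (W : 𝒳 → 𝒮 → 𝒴 → ℝ) (hW : ∀ x s, W x s ∈ simplex 𝒴)
    (ℓ : 𝒮 → ℝ) (Λ : ℝ)
    (P_X : 𝒳 → ℝ) (hP : P_X ∈ simplex 𝒳) (hPpos : ∀ x, 0 < P_X x)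
    (Q : 𝒳 × 𝒳 × 𝒮 × 𝒮 × 𝒴 → ℝ) (hQ : Q ∈ simplex (𝒳 × 𝒳 × 𝒮 × 𝒮 × 𝒴))
    (hi : ∀ x x' s y,
      (∑ s', Q (x, x', s, s', y)) =
        P_X x * (∑ x₀, ∑ s', ∑ y₀, Q (x₀, x', s, s', y₀)) * W x s y)
    (hii : ∀ x x' s' y,
      (∑ s, Q (x, x', s, s', y)) =
        P_X x' * (∑ x₀, ∑ s, ∑ y₀, Q (x, x₀, s, s', y₀)) * W x' s' y)
    (hiii : (∑ s, (∑ x, ∑ x', ∑ s', ∑ y, Q (x, x', s, s', y)) * ℓ s) ≤ Λ ∧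
      (∑ s', (∑ x, ∑ x', ∑ s, ∑ y, Q (x, x', s, s', y)) * ℓ s') ≤ Λ) :
    Lambda0 W ℓ P_X ≤ (Λ : EReal) := by
  obtain ⟨-, hP1⟩ := hP
  obtain ⟨hQ0, hQ1⟩ := hQ
  obtain ⟨hcost, hcost'⟩ := hiii
  have hWsum : ∀ x s, ∑ y, W x s y = 1 := fun x s => (hW x s).2
  set A : 𝒳 → 𝒮 → ℝ := fun x' s => ∑ x₀, ∑ s', ∑ y₀, Q (x₀, x', s, s', y₀) with hA
  set B : 𝒳 → 𝒮 → ℝ := fun x s' => ∑ x₀, ∑ s, ∑ y₀, Q (x, x₀, s, s', y₀) with hB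
  have hi' : ∀ x x' s y, ∑ s', Q (x, x', s, s', y) = P_X x * A x' s * W x s y := hi
  have hii' : ∀ x x' s' y, ∑ s, Q (x, x', s, s', y) = P_X x' * B x s' * W x' s' y := hii
  have hA0 : ∀ x s, 0 ≤ A x s := fun x s =>
    Finset.sum_nonneg fun _ _ => Finset.sum_nonneg fun _ _ => Finset.sum_nonneg fun _ _ => hQ0 _
  have hB0 : ∀ x s, 0 ≤ B x s := fun x s =>
    Finset.sum_nonneg fun _ _ => Finset.sum_nonneg fun _ _ => Finset.sum_nonneg fun _ _ => hQ0 _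
  have hexch : ∀ x x' y,
      P_X x * ∑ s, A x' s * W x s y = P_X x' * ∑ s, B x s * W x' s y := by
    intro x x' y
    have h : ∑ s, ∑ s', Q (x, x', s, s', y) = ∑ s', ∑ s, Q (x, x', s, s', y) :=
      Finset.sum_comm
    simp only [hi', hii', mul_assoc, ← Finset.mul_sum] at h
    exact h
  have hmass : ∀ x x', P_X x * ∑ s, A x' s = P_X x' * ∑ s, B x s := by
    intro x x'
    have h := Finset.sum_congr (rfl : (Finset.univ : Finset 𝒴) = _) fun y _ => hexch x x' y
    rw [← Finset.mul_sum, ← Finset.mul_sum, Finset.sum_comm,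
      Finset.sum_comm (f := fun y s => B x s * W x' s y)] at h
    simpa only [← Finset.mul_sum, hWsum, mul_one] using h
  have htotal : ∑ x', ∑ s, A x' s = 1 := by
    rw [← hQ1]
    simp only [hA, Fintype.sum_prod_type]
    conv_rhs => rw [Finset.sum_comm]
    exact Finset.sum_congr rfl fun x' _ => Finset.sum_comm
  have hBmass : ∀ x, ∑ s, B x s = P_X x := by
    intro x
    have h := Finset.sum_congr (rfl : (Finset.univ : Finset 𝒳) = _) fun x' _ => hmass x x'
    rw [← Finset.mul_sum, ← Finset.sum_mul, htotal, hP1] at h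
    linarith
  have hAmass : ∀ x, ∑ s, A x s = P_X x := by
    intro x
    have h := hmass x x
    rw [hBmass x] at h
    exact mul_left_cancel₀ (hPpos x).ne' h
  have hAcost : ∑ x, ∑ s, A x s * ℓ s ≤ Λ := by
    refine le_of_eq_of_le ?_ hcost
    rw [Finset.sum_comm]
    refine Finset.sum_congr rfl fun s _ => ?_
    rw [← Finset.sum_mul]
    congr 1
    exact Finset.sum_comm
  have hBcost : ∑ x, ∑ s, B x s * ℓ s ≤ Λ := by
    refine le_of_eq_of_le ?_ hcost'
    rw [Finset.sum_comm]
    exact Finset.sum_congr rfl fun s _ => (Finset.sum_mul ..).symm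
  set T : 𝒳 → 𝒮 → ℝ := fun x s => (A x s + B x s) / (2 * P_X x) with hT
  have hTsymm : T ∈ symmetrizers W P_X := by
    refine ⟨fun x => ⟨fun s => ?_, ?_⟩, fun y x x' hx hx' => ?_⟩
    · exact div_nonneg (add_nonneg (hA0 x s) (hB0 x s)) (by linarith [hPpos x])
    · rw [← Finset.sum_div, Finset.sum_add_distrib, hAmass, hBmass, ← two_mul]
      exact div_self (by linarith [hPpos x] : 0 < 2 * P_X x).ne'
    · have hsum : ∀ u v, ∑ s, T u s * W v s y =
          (∑ s, A u s * W v s y + ∑ s, B u s * W v s y) / (2 * P_X u) := by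
        intro u v
        rw [← Finset.sum_add_distrib, Finset.sum_div]
        exact Finset.sum_congr rfl fun s _ => by simp only [hT]; ring
      rw [hsum, hsum, div_eq_div_iff (by positivity) (by positivity)]
      linear_combination 2 * hexch x' x y - 2 * hexch x x' y
  have hTcost : ∑ x, ∑ s, P_X x * T x s * ℓ s ≤ Λ := by
    have h : ∑ x, ∑ s, P_X x * T x s * ℓ s =
        (∑ x, ∑ s, A x s * ℓ s + ∑ x, ∑ s, B x s * ℓ s) / 2 := by
      simp only [← Finset.sum_add_distrib, Finset.sum_div]
      refine Finset.sum_congr rfl fun x _ => Finset.sum_congr rfl fun s _ => ?_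
      have := (hPpos x).ne'
      simp only [hT]
      field_simp
    linarith
  exact (sInf_le (Set.mem_image_of_mem _ hTsymm)).trans (EReal.coe_le_coe_iff.2 hTcost)

end
end

section
/- Let 𝒳 = 𝒮 = 𝒴 = {0,1} with W(y|x,s) = 1 if y = x ⊕ s (addition modulo 2) and 0 otherwise. Let Γ ∈ (0,1/2] and Λ ∈ (0,1/2), let P_X be the distribution on {0,1} with P_X(1) = Γ, and P_S the distribution with P_S(1) = Λ. Then V(P_X,P_S,W) = 4·Γ·(1−Γ)·Λ·(1−Λ)·( log₂[ (Λ + Γ − 2ΛΓ) / (1 − Λ − Γ + 2ΛΓ) ] )². -/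
open Real MeasureTheory ProbabilityTheory
open scoped BigOperators ENNReal

noncomputable section

/-- Distributions on `Z` with expected cost (w.r.t. `c`) at most `B`:
the set `𝒫(Z, B)`. -/
def costSet (Z : Type*) [Fintype Z] (c : Z → ℝ) (B : ℝ) : Set (Z → ℝ) :=
  {p | p ∈ simplex Z ∧ ∑ z, p z * c z ≤ B}

variable {𝒳 𝒮 𝒴 : Type*} [Fintype 𝒳] [Fintype 𝒮] [Fintype 𝒴]

/-- The averaged channel `(P_S W)(y|x) = Σ_s P_S(s) W(y|x,s)`. -/
def PSW (W : 𝒳 → 𝒮 → 𝒴 → ℝ) (P_S : 𝒮 → ℝ) (x : 𝒳) (y : 𝒴) : ℝ :=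
  ∑ s, P_S s * W x s y

/-- The output distribution `(P_X P_S W)(y) = Σ_x P_X(x) (P_S W)(y|x)`. -/
def outDist (W : 𝒳 → 𝒮 → 𝒴 → ℝ) (P_X : 𝒳 → ℝ) (P_S : 𝒮 → ℝ) (y : 𝒴) : ℝ :=
  ∑ x, P_X x * PSW W P_S x y

/-- The information density `ı(x;y) = log₂[(P_S W)(y|x)/(P_X P_S W)(y)]`. -/
def infoDens (W : 𝒳 → 𝒮 → 𝒴 → ℝ) (P_X : 𝒳 → ℝ) (P_S : 𝒮 → ℝ) (x : 𝒳) (y : 𝒴) : ℝ :=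
  Real.logb 2 (PSW W P_S x y / outDist W P_X P_S y)

/-- The mutual information `I(P_X, P_S W)` (base 2). -/
def MI (W : 𝒳 → 𝒮 → 𝒴 → ℝ) (P_X : 𝒳 → ℝ) (P_S : 𝒮 → ℝ) : ℝ :=
  ∑ x, ∑ y, P_X x * PSW W P_S x y * infoDens W P_X P_S x y

/-- `𝔼[ı(X;Y) | X = x]`. -/
def condIX (W : 𝒳 → 𝒮 → 𝒴 → ℝ) (P_X : 𝒳 → ℝ) (P_S : 𝒮 → ℝ) (x : 𝒳) : ℝ :=
  ∑ y, PSW W P_S x y * infoDens W P_X P_S x y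

/-- `𝔼[ı(X;Y) | S = s]`. -/
def condIS (W : 𝒳 → 𝒮 → 𝒴 → ℝ) (P_X : 𝒳 → ℝ) (P_S : 𝒮 → ℝ) (s : 𝒮) : ℝ :=
  ∑ x, ∑ y, P_X x * W x s y * infoDens W P_X P_S x y

/-- The centered information density
`ĩ(x;s;y) = ı(x;y) − 𝔼[ı(X;Y)|X=x] − 𝔼[ı(X;Y)|S=s] + I(P_X, P_S W)`. -/
def itilde (W : 𝒳 → 𝒮 → 𝒴 → ℝ) (P_X : 𝒳 → ℝ) (P_S : 𝒮 → ℝ) (x : 𝒳) (s : 𝒮) (y : 𝒴) : ℝ :=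
  infoDens W P_X P_S x y - condIX W P_X P_S x - condIS W P_X P_S s + MI W P_X P_S

/-- The dispersion quantity `V(P_X, P_S, W) = 𝔼[ĩ(X;S;Y)²]`. -/
def Vdisp (W : 𝒳 → 𝒮 → 𝒴 → ℝ) (P_X : 𝒳 → ℝ) (P_S : 𝒮 → ℝ) : ℝ :=
  ∑ x, ∑ s, ∑ y, P_X x * P_S s * W x s y * (itilde W P_X P_S x s y) ^ 2

/-- **Dispersion of the binary symmetric AVC**: for the channel `y = x ⊕ s` on
`{0,1}`, input distribution `P_X(1) = Γ ∈ (0,1/2]` and state distribution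
`P_S(1) = Λ ∈ (0,1/2)`,
`V(P_X,P_S,W) = 4Γ(1−Γ)Λ(1−Λ)·(log₂[(Λ+Γ−2ΛΓ)/(1−Λ−Γ+2ΛΓ)])²`. -/
theorem Vdisp_binary_symmetric_avc (Γ Λ : ℝ)
    (hΓ0 : 0 < Γ) (hΓh : Γ ≤ 1 / 2) (hΛ0 : 0 < Λ) (hΛh : Λ < 1 / 2) :
    Vdisp (fun x s y : Fin 2 => if y = x + s then (1 : ℝ) else 0)
        (fun x : Fin 2 => if x = 1 then Γ else 1 - Γ)
        (fun s : Fin 2 => if s = 1 then Λ else 1 - Λ) =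
      4 * Γ * (1 - Γ) * Λ * (1 - Λ) *
        (Real.logb 2 ((Λ + Γ - 2 * Λ * Γ) / (1 - Λ - Γ + 2 * Λ * Γ))) ^ 2 := by
  have hq1 : 0 < Λ + Γ - 2 * Λ * Γ := by nlinarith
  have hq0 : 0 < 1 - Λ - Γ + 2 * Λ * Γ := by nlinarith
  have hΛ1 : 0 < 1 - Λ := by linarith
  have out_zero : (1 - Γ) * (1 - Λ) + Γ * Λ = 1 - Λ - Γ + 2 * Λ * Γ := by ring
  have out_one : (1 - Γ) * Λ + Γ * (1 - Λ) = Λ + Γ - 2 * Λ * Γ := by ring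
  simp [Vdisp, itilde, MI, condIX, condIS, infoDens, outDist, PSW, Fin.sum_univ_two,
    out_zero, out_one]
  rw [Real.logb_div hq1.ne' hq0.ne', Real.logb_div hΛ1.ne' hq0.ne',
    Real.logb_div hΛ0.ne' hq0.ne', Real.logb_div hΛ1.ne' hq1.ne',
    Real.logb_div hΛ0.ne' hq1.ne']
  ring

end
end

section
/- Let 𝒳, 𝒮, 𝒴 be finite nonempty sets and W a channel assigning to each (x,s) ∈ 𝒳×𝒮 a probability mass function W(·|x,s) on 𝒴. Fix a positive integer n and a type P ∈ 𝒫_n(𝒳). Let X̄ⁿ be uniformly distributed on the type class T(P) and let Yⁿ be a 𝒴ⁿ-valued random variable independent of X̄ⁿ such that, for every P_S ∈ 𝒫_n(𝒮), (U_P P_Sⁿ Wⁿ)(Yⁿ) > 0 almost surely. Then for every γ ∈ ℝ, ℙ( there exists P_S ∈ 𝒫_n(𝒮) with (P_S W)ⁿ(Yⁿ|X̄ⁿ) ≥ 2^γ · (U_P P_Sⁿ Wⁿ)(Yⁿ) ) ≤ |𝒫_n(𝒮)| · 2^{−γ}. -/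
open Real
open scoped Classical

noncomputable section

/-- The type (empirical distribution) of a length-`n` sequence. -/
def seqType {Z : Type*} [Fintype Z] [DecidableEq Z] {n : ℕ} (zn : Fin n → Z) : Z → ℝ :=
  fun z => ((Finset.univ.filter fun i => zn i = z).card : ℝ) / n

/-- `𝒫_n(Z)`: the set of types of length-`n` sequences over `Z`. -/
def typesOf (Z : Type*) [Fintype Z] [DecidableEq Z] (n : ℕ) : Set (Z → ℝ) :=
  {Q | ∃ zn : Fin n → Z, Q = seqType zn}

/-- `U_P`: the uniform distribution on the type class `T(P)`. -/
def unifType {Z : Type*} [Fintype Z] [DecidableEq Z] {n : ℕ} (P : Z → ℝ) (zn : Fin n → Z) : ℝ :=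
  if seqType zn = P then
    1 / ((Finset.univ.filter fun wn : Fin n → Z => seqType wn = P).card : ℝ)
  else 0

/-- `(P_S W)ⁿ(yⁿ|xⁿ) = ∏ᵢ Σ_s P_S(s) W(yᵢ|xᵢ,s)`. -/
def prodPSW {𝒳 𝒮 𝒴 : Type*} [Fintype 𝒮] (W : 𝒳 → 𝒮 → 𝒴 → ℝ) (P_S : 𝒮 → ℝ)
    {n : ℕ} (xn : Fin n → 𝒳) (yn : Fin n → 𝒴) : ℝ :=
  ∏ i, ∑ s, P_S s * W (xn i) s (yn i)

/-- `(U_P P_Sⁿ Wⁿ)(yⁿ) = Σ_{xⁿ ∈ T(P)} U_P(xⁿ) (P_S W)ⁿ(yⁿ|xⁿ)`. -/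
def UPout {𝒳 𝒮 𝒴 : Type*} [Fintype 𝒳] [DecidableEq 𝒳] [Fintype 𝒮]
    (W : 𝒳 → 𝒮 → 𝒴 → ℝ) (P : 𝒳 → ℝ) (P_S : 𝒮 → ℝ) {n : ℕ} (yn : Fin n → 𝒴) : ℝ :=
  ∑ xn : Fin n → 𝒳, unifType P xn * prodPSW W P_S xn yn

theorem finite_typesOf (Z : Type*) [Fintype Z] [DecidableEq Z] (n : ℕ) :
    (typesOf Z n).Finite :=
  (Set.finite_range fun zn : Fin n → Z => seqType zn).subset fun _ ⟨zn, h⟩ => ⟨zn, h.symm⟩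

theorem nonneg_of_mem_typesOf {Z : Type*} [Fintype Z] [DecidableEq Z] {n : ℕ} {Q : Z → ℝ}
    (hQ : Q ∈ typesOf Z n) (z : Z) : 0 ≤ Q z := by
  obtain ⟨zn, rfl⟩ := hQ
  unfold seqType
  positivity

theorem unifType_nonneg {Z : Type*} [Fintype Z] [DecidableEq Z] {n : ℕ} (P : Z → ℝ)
    (zn : Fin n → Z) : 0 ≤ unifType P zn := by
  unfold unifType
  split_ifs <;> positivity

theorem prodPSW_nonneg {𝒳 𝒮 𝒴 : Type*} [Fintype 𝒮] {W : 𝒳 → 𝒮 → 𝒴 → ℝ}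
    (hW : ∀ x s y, 0 ≤ W x s y) {P_S : 𝒮 → ℝ} (hP_S : ∀ s, 0 ≤ P_S s) {n : ℕ}
    (xn : Fin n → 𝒳) (yn : Fin n → 𝒴) : 0 ≤ prodPSW W P_S xn yn :=
  Finset.prod_nonneg fun _ _ => Finset.sum_nonneg fun s _ => mul_nonneg (hP_S s) (hW _ _ _)

/-- Union bound over a finite set `s` combined with Markov's inequality: each `f q` has mean
`m q` under the weights `u`. -/
theorem sum_mul_indicator_exists_le {ι κ : Type*} [Fintype ι] (u : ι → ℝ) (hu : ∀ x, 0 ≤ u x)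
    (s : Finset κ) (f : κ → ι → ℝ) (hf : ∀ q ∈ s, ∀ x, 0 ≤ f q x)
    (m : κ → ℝ) (hm : ∀ q ∈ s, 0 < m q) (hmean : ∀ q ∈ s, ∑ x, u x * f q x = m q)
    {c : ℝ} (hc : 0 < c) :
    ∑ x, u x * (if ∃ q ∈ s, c * m q ≤ f q x then 1 else 0) ≤ s.card * c⁻¹ := by
  have hind (x : ι) : (if ∃ q ∈ s, c * m q ≤ f q x then (1 : ℝ) else 0) ≤
      ∑ q ∈ s, f q x / (c * m q) := by
    have hterm : ∀ q ∈ s, 0 ≤ f q x / (c * m q) := fun q hq =>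
      div_nonneg (hf q hq x) (mul_pos hc (hm q hq)).le
    split_ifs with h
    · obtain ⟨q, hq, hle⟩ := h
      exact ((one_le_div (mul_pos hc (hm q hq))).2 hle).trans
        (Finset.single_le_sum hterm hq)
    · exact Finset.sum_nonneg hterm
  calc ∑ x, u x * (if ∃ q ∈ s, c * m q ≤ f q x then 1 else 0)
      ≤ ∑ x, u x * ∑ q ∈ s, f q x / (c * m q) :=
        Finset.sum_le_sum fun x _ => mul_le_mul_of_nonneg_left (hind x) (hu x)
    _ = ∑ q ∈ s, (∑ x, u x * f q x) / (c * m q) := by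
        simp_rw [Finset.mul_sum, Finset.sum_div, mul_div_assoc]
        exact Finset.sum_comm
    _ = ∑ q ∈ s, c⁻¹ := Finset.sum_congr rfl fun q hq => by
        have := (hm q hq).ne'
        rw [hmean q hq]
        field_simp
    _ = s.card * c⁻¹ := by simp

/-- **Union-plus-Markov bound for constant-composition random codewords**:
if `X̄ⁿ` is uniform on the type class `T(P)` and `Yⁿ` is independent of `X̄ⁿ` with any
law `ν` such that `(U_P P_Sⁿ Wⁿ)(Yⁿ) > 0` a.s. for every state type `P_S ∈ 𝒫_n(𝒮)`,
then the probability that `(P_S W)ⁿ(Yⁿ|X̄ⁿ) ≥ 2^γ (U_P P_Sⁿ Wⁿ)(Yⁿ)` for some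
`P_S ∈ 𝒫_n(𝒮)` is at most `|𝒫_n(𝒮)|·2^{−γ}`. -/
theorem union_markov_type_bound
    {𝒳 𝒮 𝒴 : Type*} [Fintype 𝒳] [Fintype 𝒮] [Fintype 𝒴]
    [Nonempty 𝒳] [Nonempty 𝒮] [Nonempty 𝒴] [DecidableEq 𝒳] [DecidableEq 𝒮]
    (W : 𝒳 → 𝒮 → 𝒴 → ℝ) (hW : ∀ x s, (∀ y, 0 ≤ W x s y) ∧ ∑ y, W x s y = 1)
    (n : ℕ) (hn : 0 < n)
    (P : 𝒳 → ℝ) (hP : P ∈ typesOf 𝒳 n)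
    (ν : (Fin n → 𝒴) → ℝ) (hν0 : ∀ yn, 0 ≤ ν yn) (hν1 : ∑ yn, ν yn = 1)
    (hpos : ∀ yn, 0 < ν yn → ∀ P_S ∈ typesOf 𝒮 n, 0 < UPout W P P_S yn)
    (γ : ℝ) :
    ∑ xn : Fin n → 𝒳, ∑ yn : Fin n → 𝒴,
        unifType P xn * ν yn *
          (if ∃ P_S ∈ typesOf 𝒮 n,
              (2 : ℝ) ^ γ * UPout W P P_S yn ≤ prodPSW W P_S xn yn then 1 else 0)
      ≤ ((typesOf 𝒮 n).ncard : ℝ) * (2 : ℝ) ^ (-γ) := by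
  have hfin := finite_typesOf 𝒮 n
  have hcond (yn : Fin n → 𝒴) (hy : 0 < ν yn) :
      ∑ xn : Fin n → 𝒳, unifType P xn *
          (if ∃ P_S ∈ typesOf 𝒮 n,
              (2 : ℝ) ^ γ * UPout W P P_S yn ≤ prodPSW W P_S xn yn then 1 else 0)
        ≤ ((typesOf 𝒮 n).ncard : ℝ) * (2 : ℝ) ^ (-γ) := by
    have h := sum_mul_indicator_exists_le (unifType (n := n) P) (unifType_nonneg P)
      hfin.toFinset (fun P_S xn => prodPSW W P_S xn yn)
      (fun P_S hP_S xn => prodPSW_nonneg (fun x s => (hW x s).1)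
        (nonneg_of_mem_typesOf (hfin.mem_toFinset.1 hP_S)) xn yn)
      (fun P_S => UPout W P P_S yn)
      (fun P_S hP_S => hpos yn hy P_S (hfin.mem_toFinset.1 hP_S))
      (fun _ _ => rfl) (rpow_pos_of_pos (two_pos : (0 : ℝ) < 2) γ)
    rw [Set.ncard_eq_toFinset_card _ hfin, rpow_neg zero_le_two]
    simpa only [hfin.mem_toFinset] using h
  rw [Finset.sum_comm]
  calc _ = ∑ yn, ν yn * ∑ xn : Fin n → 𝒳, unifType P xn *
          (if ∃ P_S ∈ typesOf 𝒮 n,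
              (2 : ℝ) ^ γ * UPout W P P_S yn ≤ prodPSW W P_S xn yn then 1 else 0) := by
        simp_rw [Finset.mul_sum]
        exact Finset.sum_congr rfl fun _ _ => Finset.sum_congr rfl fun _ _ => by ring
    _ ≤ ∑ yn, ν yn * (((typesOf 𝒮 n).ncard : ℝ) * (2 : ℝ) ^ (-γ)) :=
        Finset.sum_le_sum fun yn _ => by
          rcases (hν0 yn).eq_or_lt with h0 | hy
          · simp [← h0]
          · exact mul_le_mul_of_nonneg_left (hcond yn hy) hy.le
    _ = _ := by rw [← Finset.sum_mul, hν1, one_mul]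

end
end
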